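/- arXiv:1504.04190 — 2 statements merged into one kernel-verified Lean document; each statement's English description precedes it below -/
import Mathlib

section
/- (Benjamini–Kalai–Schramm) Let {p_n} be a sequence in [0,1] bounded away from 0 and 1, and let f_n : {0,1}^{m_n} → {0,1} be Boolean functions such that Σ_{i=1}^{m_n} I_i^{p_n}(f_n)² → 0 as n → ∞. Then the sequence {f_n} is noise sensitive with respect to {p_n}. -/
open MeasureTheory

/-- The Bernoulli(p) measure on `Bool` (probability `p` of `true`). -/
noncomputable def bern (p : ℝ) : Measure Bool :=
  ENNReal.ofReal p • Measure.dirac true + ENNReal.ofReal (1 - p) • Measure.dirac false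

/-- Joint law of (ω_i, fresh bit, resample indicator) per coordinate. -/
noncomputable def noiseμ (m : ℕ) (p ε : ℝ) : Measure (Fin m → Bool × Bool × Bool) :=
  Measure.pi fun _ => (bern p).prod ((bern p).prod (bern ε))

/-- The original configuration ω. -/
def obs {m : ℕ} (σ : Fin m → Bool × Bool × Bool) : Fin m → Bool := fun i => (σ i).1

/-- The noised configuration ω^ε. -/
def pert {m : ℕ} (σ : Fin m → Bool × Bool × Bool) : Fin m → Bool :=
  fun i => if (σ i).2.2 then (σ i).2.1 else (σ i).1

/-- A Boolean as a real number. -/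
noncomputable def bval (b : Bool) : ℝ := if b then 1 else 0

/-- The influence `I_i^p(f) = P(f(ω) ≠ f(ω^i))`, where `ω` has i.i.d. Bernoulli(p)
coordinates and `ω^i` is `ω` with coordinate `i` replaced by a fresh Bernoulli(p) bit. -/
noncomputable def influence (m : ℕ) (p : ℝ) (f : (Fin m → Bool) → Bool) (i : Fin m) : ℝ :=
  (((Measure.pi fun _ : Fin m => bern p).prod (bern p))
    {σ | f σ.1 ≠ f (Function.update σ.1 i σ.2)}).toReal

/-- The Bernoulli(p) mass function. -/
noncomputable def bwt (p : ℝ) (b : Bool) : ℝ := if b then p else 1 - p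

/-- The product Bernoulli(p) mass function. -/
noncomputable def wt {m : ℕ} (p : ℝ) (x : Fin m → Bool) : ℝ := ∏ i, bwt p (x i)

/-- The one-bit kernel which keeps the bit with probability `r` and refreshes it otherwise. -/
noncomputable def site (p r : ℝ) (a b : Bool) : ℝ :=
  (if a = b then r else 0) + (1 - r) * bwt p b

/-- The product kernel which keeps coordinate `i` with probability `r i`. -/
noncomputable def noiseKer {m : ℕ} (p : ℝ) (r : Fin m → ℝ) (x y : Fin m → Bool) : ℝ :=
  ∏ i, site p (r i) (x i) (y i)

/-- The Markov operator of `noiseKer`. -/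
noncomputable def noiseOp {m : ℕ} (p : ℝ) (r : Fin m → ℝ) (g : (Fin m → Bool) → ℝ) :
    (Fin m → Bool) → ℝ :=
  fun x => ∑ y, noiseKer p r x y * g y

/-- The `L²` inner product for the product Bernoulli(p) measure. -/
noncomputable def corr {m : ℕ} (p : ℝ) (g h : (Fin m → Bool) → ℝ) : ℝ :=
  ∑ x, wt p x * (g x * h x)

/-- The `L¹` norm for the product Bernoulli(p) measure. -/
noncomputable def absMean {m : ℕ} (p : ℝ) (g : (Fin m → Bool) → ℝ) : ℝ :=
  ∑ x, wt p x * |g x|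

/-- Retention probabilities `r` on the coordinates in `S` and `1` elsewhere. -/
noncomputable def retainOn {m : ℕ} (S : Finset (Fin m)) (r : ℝ) : Fin m → ℝ :=
  fun j => if j ∈ S then r else 1

/-- The discrete Laplacian in direction `i`: `g` minus its average over coordinate `i`. -/
noncomputable def coordLap {m : ℕ} (p : ℝ) (i : Fin m) (g : (Fin m → Bool) → ℝ) :
    (Fin m → Bool) → ℝ :=
  g - noiseOp p (retainOn {i} 0) g

section
variable {m : ℕ} {p : ℝ}

lemma bwt_nonneg (h0 : 0 ≤ p) (h1 : p ≤ 1) (b : Bool) : 0 ≤ bwt p b := by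
  cases b <;> simp [bwt] <;> linarith

lemma wt_nonneg (h0 : 0 ≤ p) (h1 : p ≤ 1) (x : Fin m → Bool) : 0 ≤ wt p x :=
  Finset.prod_nonneg fun _ _ => bwt_nonneg h0 h1 _

lemma sum_bwt : ∑ b, bwt p b = 1 := by simp [bwt]

lemma sum_wt : ∑ x : Fin m → Bool, wt p x = 1 := by
  simp only [wt, ← Fintype.prod_sum (fun _ : Fin m => bwt p), sum_bwt, Finset.prod_const_one]

lemma site_nonneg (h0 : 0 ≤ p) (h1 : p ≤ 1) {r : ℝ} (hr0 : 0 ≤ r) (hr1 : r ≤ 1) (a b : Bool) :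
    0 ≤ site p r a b := by
  unfold site
  have := mul_nonneg (sub_nonneg.2 hr1) (bwt_nonneg h0 h1 b)
  split_ifs <;> linarith

lemma sum_site (r : ℝ) (a : Bool) : ∑ b, site p r a b = 1 := by
  cases a <;> simp [site, bwt] <;> ring

lemma site_reversible (r : ℝ) (a b : Bool) :
    bwt p a * site p r a b = bwt p b * site p r b a := by
  cases a <;> cases b <;> simp [site, bwt] <;> ring

lemma sum_site_mul_site (r s : ℝ) (a c : Bool) :
    ∑ b, site p r a b * site p s b c = site p (r * s) a c := by
  cases a <;> cases c <;> simp [site, bwt] <;> ring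

lemma noiseKer_nonneg (h0 : 0 ≤ p) (h1 : p ≤ 1) {r : Fin m → ℝ} (hr0 : ∀ i, 0 ≤ r i)
    (hr1 : ∀ i, r i ≤ 1) (x y : Fin m → Bool) : 0 ≤ noiseKer p r x y :=
  Finset.prod_nonneg fun _ _ => site_nonneg h0 h1 (hr0 _) (hr1 _) _ _

lemma sum_noiseKer (r : Fin m → ℝ) (x : Fin m → Bool) : ∑ y, noiseKer p r x y = 1 := by
  simp only [noiseKer, ← Fintype.prod_sum (fun i => site p (r i) (x i)), sum_site,
    Finset.prod_const_one]

lemma noiseKer_reversible (r : Fin m → ℝ) (x y : Fin m → Bool) :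
    wt p x * noiseKer p r x y = wt p y * noiseKer p r y x := by
  simp only [wt, noiseKer, ← Finset.prod_mul_distrib, site_reversible]

lemma sum_noiseKer_mul_noiseKer (r s : Fin m → ℝ) (x z : Fin m → Bool) :
    ∑ y, noiseKer p r x y * noiseKer p s y z = noiseKer p (r * s) x z := by
  simp only [noiseKer, ← Finset.prod_mul_distrib,
    ← Fintype.prod_sum (fun i b => site p (r i) (x i) b * site p (s i) b (z i)),
    sum_site_mul_site, Pi.mul_apply]

lemma noiseOp_noiseOp (r s : Fin m → ℝ) (g : (Fin m → Bool) → ℝ) :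
    noiseOp p r (noiseOp p s g) = noiseOp p (r * s) g := by
  funext x
  simp only [noiseOp, ← sum_noiseKer_mul_noiseKer, Finset.mul_sum, Finset.sum_mul]
  rw [Finset.sum_comm]
  simp only [mul_assoc]

lemma noiseOp_comm (r s : Fin m → ℝ) (g : (Fin m → Bool) → ℝ) :
    noiseOp p r (noiseOp p s g) = noiseOp p s (noiseOp p r g) := by
  rw [noiseOp_noiseOp, noiseOp_noiseOp, mul_comm]

lemma noiseOp_sub (r : Fin m → ℝ) (g h : (Fin m → Bool) → ℝ) :
    noiseOp p r (g - h) = noiseOp p r g - noiseOp p r h := by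
  funext x
  simp [noiseOp, mul_sub, Finset.sum_sub_distrib]

lemma noiseOp_one (g : (Fin m → Bool) → ℝ) : noiseOp p 1 g = g := by
  have key (x y : Fin m → Bool) : noiseKer p 1 x y = if x = y then 1 else 0 := by
    split_ifs with h
    · simp [noiseKer, site, h]
    · obtain ⟨i, hi⟩ := Function.ne_iff.1 h
      exact Finset.prod_eq_zero (Finset.mem_univ i) (by simp [site, hi])
  funext x
  simp [noiseOp, key]

lemma noiseOp_coordLap (r : Fin m → ℝ) (i : Fin m) (g : (Fin m → Bool) → ℝ) :
    noiseOp p r (coordLap p i g) = coordLap p i (noiseOp p r g) := by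
  rw [coordLap, noiseOp_sub, noiseOp_comm, coordLap]

lemma retainOn_insert {S : Finset (Fin m)} {i : Fin m} (hi : i ∉ S) (r : ℝ) :
    retainOn (insert i S) r = retainOn {i} r * retainOn S r := by
  funext j
  by_cases hj : j = i
  · simp [retainOn, hj, hi]
  · simp [retainOn, hj]

lemma retainOn_univ (r : ℝ) : retainOn (Finset.univ : Finset (Fin m)) r = fun _ => r := by
  funext j
  simp [retainOn]

lemma retainOn_mem_Icc {S : Finset (Fin m)} {r : ℝ} (hr0 : 0 ≤ r) (hr1 : r ≤ 1) (i : Fin m) :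
    0 ≤ retainOn S r i ∧ retainOn S r i ≤ 1 := by
  unfold retainOn
  split_ifs <;> simp [hr0, hr1]

lemma noiseOp_retainOn_singleton (i : Fin m) (r : ℝ) (g : (Fin m → Bool) → ℝ) :
    noiseOp p (retainOn {i} r) g = g - (1 - r) • coordLap p i g := by
  have hker (t : ℝ) (x y : Fin m → Bool) : noiseKer p (retainOn {i} t) x y =
      site p t (x i) (y i) * ∏ j ∈ Finset.univ.erase i, site p 1 (x j) (y j) := by
    rw [noiseKer, ← Finset.mul_prod_erase _ _ (Finset.mem_univ i)]
    congr 1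
    · simp [retainOn]
    · exact Finset.prod_congr rfl fun j hj => by simp [retainOn, Finset.ne_of_mem_erase hj]
  have hg : g = noiseOp p (retainOn {i} 1) g := by
    conv_lhs => rw [← noiseOp_one (p := p) g]
    congr 1
    funext j
    simp [retainOn]
  rw [coordLap]
  conv_rhs => rw [hg]
  rw [noiseOp_noiseOp, show retainOn {i} 0 * retainOn {i} 1 = retainOn {i} (0 : ℝ) by
    funext j; by_cases hj : j = i <;> simp [retainOn, hj]]
  funext x
  simp only [noiseOp, Pi.sub_apply, Pi.smul_apply, smul_eq_mul, hker, Finset.mul_sum,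
    ← Finset.sum_sub_distrib]
  refine Finset.sum_congr rfl fun y _ => ?_
  simp only [site]
  split_ifs <;> ring

lemma corr_comm (g h : (Fin m → Bool) → ℝ) : corr p g h = corr p h g := by
  simp only [corr, mul_comm]

lemma corr_sub_right (g h k : (Fin m → Bool) → ℝ) :
    corr p g (h - k) = corr p g h - corr p g k := by
  simp [corr, mul_sub, Finset.sum_sub_distrib]

lemma corr_smul_right (c : ℝ) (g h : (Fin m → Bool) → ℝ) :
    corr p g (c • h) = c * corr p g h := by
  simp only [corr, Pi.smul_apply, smul_eq_mul, Finset.mul_sum]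
  exact Finset.sum_congr rfl fun _ _ => by ring

lemma corr_sub_left (g h k : (Fin m → Bool) → ℝ) :
    corr p (g - h) k = corr p g k - corr p h k := by
  rw [corr_comm, corr_sub_right, corr_comm k, corr_comm k]

lemma corr_smul_left (c : ℝ) (g h : (Fin m → Bool) → ℝ) :
    corr p (c • g) h = c * corr p g h := by
  rw [corr_comm, corr_smul_right, corr_comm]

lemma corr_self_nonneg (h0 : 0 ≤ p) (h1 : p ≤ 1) (g : (Fin m → Bool) → ℝ) : 0 ≤ corr p g g :=
  Finset.sum_nonneg fun x _ => mul_nonneg (wt_nonneg h0 h1 x) (mul_self_nonneg _)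

lemma absMean_nonneg (h0 : 0 ≤ p) (h1 : p ≤ 1) (g : (Fin m → Bool) → ℝ) : 0 ≤ absMean p g :=
  Finset.sum_nonneg fun x _ => mul_nonneg (wt_nonneg h0 h1 x) (abs_nonneg _)

lemma corr_sq_le (h0 : 0 ≤ p) (h1 : p ≤ 1) (g h : (Fin m → Bool) → ℝ) :
    corr p g h ^ 2 ≤ corr p g g * corr p h h :=
  Finset.sum_sq_le_sum_mul_sum_of_sq_le_mul _
    (fun x _ => mul_nonneg (wt_nonneg h0 h1 x) (mul_self_nonneg _))
    (fun x _ => mul_nonneg (wt_nonneg h0 h1 x) (mul_self_nonneg _))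
    (fun x _ => le_of_eq (by ring))

lemma sum_wt_mul_noiseOp (r : Fin m → ℝ) (g : (Fin m → Bool) → ℝ) :
    ∑ x, wt p x * noiseOp p r g x = ∑ x, wt p x * g x := by
  calc ∑ x, wt p x * noiseOp p r g x
      = ∑ x, ∑ y, wt p y * g y * noiseKer p r y x := by
        refine Finset.sum_congr rfl fun x _ => ?_
        rw [noiseOp, Finset.mul_sum]
        refine Finset.sum_congr rfl fun y _ => ?_
        linear_combination g y * noiseKer_reversible (p := p) r x y
    _ = ∑ x, wt p x * g x := by
        rw [Finset.sum_comm]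
        simp only [← Finset.mul_sum, sum_noiseKer, mul_one]

lemma corr_noiseOp (r : Fin m → ℝ) (g h : (Fin m → Bool) → ℝ) :
    corr p g (noiseOp p r h) = corr p (noiseOp p r g) h := by
  simp only [corr, noiseOp, Finset.mul_sum, Finset.sum_mul]
  rw [Finset.sum_comm]
  refine Finset.sum_congr rfl fun y _ => Finset.sum_congr rfl fun x _ => ?_
  linear_combination g x * h y * noiseKer_reversible (p := p) r x y

lemma corr_noiseOp_self_le (h0 : 0 ≤ p) (h1 : p ≤ 1) {r : Fin m → ℝ} (hr0 : ∀ i, 0 ≤ r i)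
    (hr1 : ∀ i, r i ≤ 1) (g : (Fin m → Bool) → ℝ) :
    corr p (noiseOp p r g) (noiseOp p r g) ≤ corr p g g := by
  have hK := noiseKer_nonneg h0 h1 hr0 hr1
  have pt (x : Fin m → Bool) :
      noiseOp p r g x * noiseOp p r g x ≤ noiseOp p r (fun y => g y * g y) x := by
    have := Finset.sum_sq_le_sum_mul_sum_of_sq_le_mul Finset.univ
      (r := fun y => noiseKer p r x y * g y) (f := noiseKer p r x)
      (g := fun y => noiseKer p r x y * (g y * g y))
      (fun y _ => hK x y) (fun y _ => mul_nonneg (hK x y) (mul_self_nonneg _))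
      (fun y _ => le_of_eq (by ring))
    rw [sum_noiseKer, one_mul, sq] at this
    exact this
  calc corr p (noiseOp p r g) (noiseOp p r g)
      ≤ ∑ x, wt p x * noiseOp p r (fun y => g y * g y) x :=
        Finset.sum_le_sum fun x _ => mul_le_mul_of_nonneg_left (pt x) (wt_nonneg h0 h1 x)
    _ = corr p g g := sum_wt_mul_noiseOp r _

lemma absMean_noiseOp_le (h0 : 0 ≤ p) (h1 : p ≤ 1) {r : Fin m → ℝ} (hr0 : ∀ i, 0 ≤ r i)
    (hr1 : ∀ i, r i ≤ 1) (g : (Fin m → Bool) → ℝ) :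
    absMean p (noiseOp p r g) ≤ absMean p g := by
  have hK := noiseKer_nonneg h0 h1 hr0 hr1
  calc absMean p (noiseOp p r g) ≤ ∑ x, wt p x * noiseOp p r (fun y => |g y|) x := by
        refine Finset.sum_le_sum fun x _ => mul_le_mul_of_nonneg_left ?_ (wt_nonneg h0 h1 x)
        refine (Finset.abs_sum_le_sum_abs _ _).trans_eq (Finset.sum_congr rfl fun y _ => ?_)
        rw [abs_mul, abs_of_nonneg (hK x y)]
    _ = absMean p g := sum_wt_mul_noiseOp r _

/-- Refreshing one coordinate shrinks only the Laplacian component. -/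
lemma corr_self_sub_corr_retainOn_singleton (i : Fin m) (r : ℝ) (g : (Fin m → Bool) → ℝ) :
    corr p g g - corr p (noiseOp p (retainOn {i} r) g) (noiseOp p (retainOn {i} r) g) =
      (1 - r ^ 2) * corr p (coordLap p i g) (coordLap p i g) := by
  have horth : corr p g (coordLap p i g) = corr p (coordLap p i g) (coordLap p i g) := by
    have : corr p (noiseOp p (retainOn {i} 0) g) (coordLap p i g) = 0 := by
      rw [← corr_noiseOp, coordLap, noiseOp_sub, noiseOp_noiseOp]
      have : retainOn {i} 0 * retainOn {i} 0 = retainOn {i} (0 : ℝ) := by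
        funext j; by_cases hj : j = i <;> simp [retainOn, hj]
      simp [this, corr]
    conv_rhs => enter [2]; rw [coordLap]
    rw [corr_sub_left, this, sub_zero]
  rw [noiseOp_retainOn_singleton]
  simp only [corr_sub_left, corr_sub_right, corr_smul_left, corr_smul_right,
    corr_comm (coordLap p i g) g, horth]
  ring

lemma noiseOp_retainOn_insert {S : Finset (Fin m)} {i : Fin m} (hi : i ∉ S) (r : ℝ)
    (g : (Fin m → Bool) → ℝ) : noiseOp p (retainOn (insert i S) r) g =
      noiseOp p (retainOn {i} r) (noiseOp p (retainOn S r) g) := by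
  rw [noiseOp_noiseOp, retainOn_insert hi]

/-- The Efron–Stein inequality. -/
lemma corr_self_sub_le_sum_coordLap (h0 : 0 ≤ p) (h1 : p ≤ 1) (g : (Fin m → Bool) → ℝ)
    (S : Finset (Fin m)) :
    corr p g g - corr p (noiseOp p (retainOn S 0) g) (noiseOp p (retainOn S 0) g) ≤
      ∑ i ∈ S, corr p (coordLap p i g) (coordLap p i g) := by
  induction S using Finset.induction_on with
  | empty =>
    have : retainOn (∅ : Finset (Fin m)) 0 = 1 := by funext j; simp [retainOn]
    simp [this, noiseOp_one]
  | insert i S hi ih =>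
    rw [Finset.sum_insert hi, noiseOp_retainOn_insert hi]
    have h := corr_self_sub_corr_retainOn_singleton (p := p) i 0 (noiseOp p (retainOn S 0) g)
    rw [← noiseOp_coordLap] at h
    have hb := retainOn_mem_Icc (S := S) le_rfl zero_le_one
    have := corr_noiseOp_self_le h0 h1 (fun i => (hb i).1) (fun i => (hb i).2) (coordLap p i g)
    linarith

/-- Noise makes the total `L²` mass of the Laplacians bounded. -/
lemma sum_corr_noiseOp_coordLap_le (h0 : 0 ≤ p) (h1 : p ≤ 1) {r : ℝ} (hr0 : 0 ≤ r) (hr1 : r ≤ 1)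
    (g : (Fin m → Bool) → ℝ) (S : Finset (Fin m)) :
    (1 - r ^ 2) * ∑ i ∈ S, corr p (noiseOp p (fun _ => r) (coordLap p i g))
        (noiseOp p (fun _ => r) (coordLap p i g)) ≤
      corr p g g - corr p (noiseOp p (retainOn S r) g) (noiseOp p (retainOn S r) g) := by
  induction S using Finset.induction_on with
  | empty =>
    have : retainOn (∅ : Finset (Fin m)) r = 1 := by funext j; simp [retainOn]
    simp [this, noiseOp_one]
  | insert i S hi ih =>
    rw [Finset.sum_insert hi, noiseOp_retainOn_insert hi]
    have h := corr_self_sub_corr_retainOn_singleton (p := p) i r (noiseOp p (retainOn S r) g)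
    rw [← noiseOp_coordLap] at h
    have hb := retainOn_mem_Icc (S := Sᶜ) hr0 hr1
    have hle := corr_noiseOp_self_le h0 h1 (fun i => (hb i).1) (fun i => (hb i).2)
      (noiseOp p (retainOn S r) (coordLap p i g))
    have hsplit : retainOn Sᶜ r * retainOn S r = fun _ => r := by
      funext j
      by_cases hj : j ∈ S <;> simp [retainOn, hj]
    rw [noiseOp_noiseOp, hsplit] at hle
    have := mul_le_mul_of_nonneg_left hle (by nlinarith : 0 ≤ 1 - r ^ 2)
    linarith

end

section
variable {m : ℕ} {p : ℝ}

lemma two_point_hypercontractive {δ : ℝ} (hδ : 0 < δ) (h0 : δ ≤ p) (h1 : p ≤ 1 - δ) (u v : ℝ) :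
    p * (site p (δ / 2) true true * u + site p (δ / 2) true false * v) ^ 4 +
      (1 - p) * (site p (δ / 2) false true * u + site p (δ / 2) false false * v) ^ 4 ≤
      (p * u ^ 2 + (1 - p) * v ^ 2) ^ 2 := by
  set s := δ / 2 with hs
  set q := 1 - p with hq
  set a := p * u + q * v with ha
  set d := u - v with hd
  have hp : p = 1 - q := by linarith
  have e1 : site p s true true * u + site p s true false * v = a + s * q * d := by
    simp [site, bwt, ha, hd, hq]; ring
  have e2 : site p s false true * u + site p s false false * v = a - s * p * d := by
    simp [site, bwt, ha, hd, hq]; ring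
  have e3 : p * u ^ 2 + q * v ^ 2 = a ^ 2 + p * q * d ^ 2 := by
    rw [ha, hd, hp]; ring
  rw [e1, e2, e3]
  have hpq : δ / 2 ≤ p * q := by nlinarith
  have hδ2 : δ ≤ 1 / 2 := by linarith
  have hs0 : 0 < s := by positivity
  have hs4 : s ≤ 1 / 4 := by linarith
  have hq1 : q ≤ 1 := by linarith
  have hp0 : 0 ≤ p := by linarith
  have hq0 : 0 ≤ q := by linarith
  have key : 6 * s ^ 2 * a ^ 2 + 4 * s ^ 3 * (a * d * (q - p)) +
      s ^ 4 * d ^ 2 * (1 - 3 * (p * q)) ≤ 2 * a ^ 2 + p * q * d ^ 2 := by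
    have hc : (q - p) ^ 2 ≤ 1 := by rw [sq_le_one_iff_abs_le_one, abs_le]; constructor <;> linarith
    have h3 : 2 * (a * d * (q - p)) * s ≤ a ^ 2 + s ^ 2 * d ^ 2 := by
      have h := mul_le_mul_of_nonneg_left hc (sq_nonneg (s * d))
      linarith [sq_nonneg (a - s * d * (q - p))]
    have h3' := mul_le_mul_of_nonneg_left h3 (by positivity : 0 ≤ 2 * s ^ 2)
    have h4 : 0 ≤ s ^ 4 * d ^ 2 * (p * q) := by positivity
    have h5 : 8 * s ^ 2 * a ^ 2 ≤ 2 * a ^ 2 :=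
      mul_le_mul_of_nonneg_right (by nlinarith only [hs0, hs4]) (sq_nonneg a)
    have h6 : 3 * s ^ 4 * d ^ 2 ≤ p * q * d ^ 2 := by
      refine mul_le_mul_of_nonneg_right ?_ (sq_nonneg d)
      have h7 : s ^ 3 ≤ (1 / 4) ^ 3 := by gcongr
      have h8 := mul_le_mul_of_nonneg_left h7 hs0.le
      linarith
    linarith
  have h9 := mul_le_mul_of_nonneg_left key (by positivity : 0 ≤ p * q * d ^ 2)
  have hexp : p * (a + s * q * d) ^ 4 + q * (a - s * p * d) ^ 4 = a ^ 4 + p * q * d ^ 2 *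
      (6 * s ^ 2 * a ^ 2 + 4 * s ^ 3 * (a * d * (q - p)) + s ^ 4 * d ^ 2 * (1 - 3 * (p * q))) := by
    rw [hp]; ring
  rw [hexp]
  linarith

lemma sum_cons {m : ℕ} (F : (Fin (m + 1) → Bool) → ℝ) :
    ∑ x, F x = ∑ x : Fin m → Bool,
      (F (Fin.cons (α := fun _ => Bool) true x) + F (Fin.cons (α := fun _ => Bool) false x)) := by
  rw [← (Fin.consEquiv (fun _ : Fin (m + 1) => Bool)).sum_comp, Fintype.sum_prod_type,
    Fintype.sum_bool, ← Finset.sum_add_distrib]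
  rfl

/-- The Bonami hypercontractive inequality from `L²` to `L⁴`. -/
lemma corr_sq_noiseOp_le {δ : ℝ} (hδ : 0 < δ) (h0 : δ ≤ p) (h1 : p ≤ 1 - δ) :
    ∀ {m : ℕ} (g : (Fin m → Bool) → ℝ),
      ∑ x, wt p x * noiseOp p (fun _ => δ / 2) g x ^ 4 ≤ corr p g g ^ 2
  | 0, g => by
    simp [wt, noiseOp, noiseKer, corr]
    exact le_of_eq (by ring)
  | m + 1, g => by
    set σ := δ / 2
    set gt : (Fin m → Bool) → ℝ := fun x => g (Fin.cons (α := fun _ => Bool) true x) with hgt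
    set gf : (Fin m → Bool) → ℝ := fun x => g (Fin.cons (α := fun _ => Bool) false x) with hgf
    have iht := corr_sq_noiseOp_le hδ h0 h1 gt
    have ihf := corr_sq_noiseOp_le hδ h0 h1 gf
    set A := noiseOp p (fun _ => σ) gt with hA
    set B := noiseOp p (fun _ => σ) gf with hB
    have hw (b : Bool) (x : Fin m → Bool) :
        wt p (Fin.cons (α := fun _ => Bool) b x) = bwt p b * wt p x := by
      simp [wt, Fin.prod_univ_succ]
    have hT (b : Bool) (x : Fin m → Bool) :
        noiseOp p (fun _ => σ) g (Fin.cons (α := fun _ => Bool) b x) =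
          site p σ b true * A x + site p σ b false * B x := by
      simp only [hA, hB, noiseOp, sum_cons, noiseKer, Fin.prod_univ_succ, Fin.cons_zero,
        Fin.cons_succ, Finset.mul_sum, ← Finset.sum_add_distrib, mul_assoc, hgt, hgf]
    have hcorr : corr p g g = p * corr p gt gt + (1 - p) * corr p gf gf := by
      simp only [corr, sum_cons, hw, Finset.mul_sum, ← Finset.sum_add_distrib]
      exact Finset.sum_congr rfl fun x _ => by simp [bwt, hgt, hgf]; ring
    have hp0 : 0 ≤ p := by linarith
    have hp1 : p ≤ 1 := by linarith
    have hcross : ∑ x, wt p x * (A x ^ 2 * B x ^ 2) ≤ corr p gt gt * corr p gf gf := by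
      refine abs_le_of_sq_le_sq' ?_ (mul_nonneg (corr_self_nonneg hp0 hp1 _)
        (corr_self_nonneg hp0 hp1 _)) |>.2
      rw [mul_pow]
      refine (corr_sq_le hp0 hp1 (fun x => A x ^ 2) (fun x => B x ^ 2)).trans ?_
      refine mul_le_mul ?_ ?_ (corr_self_nonneg hp0 hp1 _) (sq_nonneg _)
      · simpa only [corr, ← pow_add] using iht
      · simpa only [corr, ← pow_add] using ihf
    calc ∑ x, wt p x * noiseOp p (fun _ => σ) g x ^ 4
        ≤ ∑ x, wt p x * (p * A x ^ 2 + (1 - p) * B x ^ 2) ^ 2 := by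
          rw [sum_cons]
          refine Finset.sum_le_sum fun x _ => ?_
          have := mul_le_mul_of_nonneg_left
            (two_point_hypercontractive hδ h0 h1 (A x) (B x)) (wt_nonneg hp0 hp1 x)
          simp only [hw, hT, bwt]
          simp only [if_true, Bool.false_eq_true, if_false]
          linarith
      _ = p ^ 2 * ∑ x, wt p x * A x ^ 4 + (1 - p) ^ 2 * ∑ x, wt p x * B x ^ 4 +
            2 * p * (1 - p) * ∑ x, wt p x * (A x ^ 2 * B x ^ 2) := by
          simp only [Finset.mul_sum, ← Finset.sum_add_distrib]
          exact Finset.sum_congr rfl fun x _ => by ring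
      _ ≤ p ^ 2 * corr p gt gt ^ 2 + (1 - p) ^ 2 * corr p gf gf ^ 2 +
            2 * p * (1 - p) * (corr p gt gt * corr p gf gf) := by
          have : 0 ≤ 1 - p := by linarith
          gcongr
      _ = corr p g g ^ 2 := by rw [hcorr]; ring

/-- A consequence of hypercontractivity: noise makes the squared `L²` norm at most the product
of the `L¹` and `L²` norms. -/
lemma corr_noiseOp_sq_le {δ : ℝ} (hδ : 0 < δ) (h0 : δ ≤ p) (h1 : p ≤ 1 - δ)
    (g : (Fin m → Bool) → ℝ) :
    corr p (noiseOp p (fun _ => δ / 2) g) (noiseOp p (fun _ => δ / 2) g) ^ 2 ≤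
      absMean p g ^ 2 * corr p g g := by
  have hp0 : 0 ≤ p := by linarith
  have hp1 : p ≤ 1 := by linarith
  have hw := wt_nonneg (m := m) hp0 hp1
  set T := noiseOp (m := m) p (fun _ => δ / 2)
  set B := corr p (T g) (T g) with hB
  set G := T (T g) with hG
  have hB0 : 0 ≤ B := corr_self_nonneg hp0 hp1 _
  have hBG : B = ∑ x, wt p x * (g x * G x) := (corr_noiseOp _ _ _).symm
  have h4 : ∑ x, wt p x * G x ^ 4 ≤ B ^ 2 := corr_sq_noiseOp_le hδ h0 h1 (T g)
  set D := ∑ x, wt p x * (|g x| * G x ^ 2) with hD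
  have hc1 : B ^ 2 ≤ absMean p g * D := by
    rw [hBG]
    refine Finset.sum_sq_le_sum_mul_sum_of_sq_le_mul _
      (fun x _ => mul_nonneg (hw x) (abs_nonneg _))
      (fun x _ => mul_nonneg (hw x) (by positivity)) (fun x _ => le_of_eq ?_)
    rw [mul_pow, mul_pow, ← sq_abs (g x)]; ring
  have hc2 : D ^ 2 ≤ corr p g g * ∑ x, wt p x * G x ^ 4 := by
    refine Finset.sum_sq_le_sum_mul_sum_of_sq_le_mul _
      (fun x _ => mul_nonneg (hw x) (mul_self_nonneg _))
      (fun x _ => mul_nonneg (hw x) (by positivity)) (fun x _ => le_of_eq ?_)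
    rw [mul_pow, mul_pow, sq_abs]; ring
  have hg0 := corr_self_nonneg hp0 hp1 g
  have h5 : B ^ 2 * B ^ 2 ≤ absMean p g ^ 2 * corr p g g * B ^ 2 := by
    calc B ^ 2 * B ^ 2 = (B ^ 2) ^ 2 := by ring
      _ ≤ (absMean p g * D) ^ 2 := by gcongr
      _ = absMean p g ^ 2 * D ^ 2 := by ring
      _ ≤ absMean p g ^ 2 * (corr p g g * B ^ 2) := by
        gcongr
        exact hc2.trans (by gcongr)
      _ = _ := by ring
  rcases hB0.eq_or_lt with h | h
  · rw [← h]
    simpa using mul_nonneg (sq_nonneg _) hg0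
  · exact le_of_mul_le_mul_right h5 (by positivity)

/-- The excess of `E[g(ω) g(ω')]` over `E[g]²`, where `ω'` keeps each bit of `ω` with
probability `r`. -/
noncomputable def noiseCov (p : ℝ) (g : (Fin m → Bool) → ℝ) (r : ℝ) : ℝ :=
  corr p g (noiseOp p (fun _ => r) g) - corr p g (noiseOp p (fun _ => 0) g)

lemma noiseOp_const_noiseOp_const (r s : ℝ) (g : (Fin m → Bool) → ℝ) :
    noiseOp p (fun _ => r) (noiseOp p (fun _ => s) g) = noiseOp p (fun _ => r * s) g :=
  noiseOp_noiseOp _ _ _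

lemma corr_noiseOp_const (r s : ℝ) (g : (Fin m → Bool) → ℝ) :
    corr p (noiseOp p (fun _ => r) g) (noiseOp p (fun _ => s) g) =
      corr p g (noiseOp p (fun _ => r * s) g) := by
  rw [← corr_noiseOp, noiseOp_const_noiseOp_const]

lemma noiseCov_sq_eq (r : ℝ) (g : (Fin m → Bool) → ℝ) : noiseCov p g (r ^ 2) =
    corr p (noiseOp p (fun _ => r) g - noiseOp p (fun _ => 0) g)
      (noiseOp p (fun _ => r) g - noiseOp p (fun _ => 0) g) := by
  simp only [noiseCov, corr_sub_left, corr_sub_right, corr_noiseOp_const, mul_zero, zero_mul, sq]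
  ring

lemma noiseCov_sq_nonneg (h0 : 0 ≤ p) (h1 : p ≤ 1) (r : ℝ) (g : (Fin m → Bool) → ℝ) :
    0 ≤ noiseCov p g (r ^ 2) := by
  rw [noiseCov_sq_eq]
  exact corr_self_nonneg h0 h1 _

lemma sq_noiseCov_le (h0 : 0 ≤ p) (h1 : p ≤ 1) {g : (Fin m → Bool) → ℝ} (hg : corr p g g ≤ 1)
    (r : ℝ) : noiseCov p g r ^ 2 ≤ noiseCov p g (r ^ 2) := by
  have h := noiseCov_sq_nonneg h0 h1 r g
  rw [noiseCov, ← corr_sub_right]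
  refine (corr_sq_le h0 h1 _ _).trans ?_
  rw [← noiseCov_sq_eq]
  nlinarith

lemma noiseCov_sq_mono (h0 : 0 ≤ p) (h1 : p ≤ 1) {r s : ℝ} (hr : 0 ≤ r) (hrs : r ≤ s)
    (g : (Fin m → Bool) → ℝ) : noiseCov p g (r ^ 2) ≤ noiseCov p g (s ^ 2) := by
  rcases (hr.trans hrs).eq_or_lt with h | h
  · rw [le_antisymm (hrs.trans h.symm.le) hr, ← h]
  rw [noiseCov_sq_eq, noiseCov_sq_eq]
  have := corr_noiseOp_self_le (m := m) h0 h1 (r := fun _ => r / s) (fun _ => by positivity)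
    (fun _ => (div_le_one h).2 hrs) (noiseOp p (fun _ => s) g - noiseOp p (fun _ => 0) g)
  rwa [noiseOp_sub, noiseOp_const_noiseOp_const, noiseOp_const_noiseOp_const, mul_zero,
    div_mul_cancel₀ _ h.ne'] at this

lemma pow_noiseCov_le (h0 : 0 ≤ p) (h1 : p ≤ 1) {g : (Fin m → Bool) → ℝ} (hg : corr p g g ≤ 1)
    (r : ℝ) (j : ℕ) : noiseCov p g r ^ 2 ^ (j + 1) ≤ noiseCov p g (r ^ 2 ^ (j + 1)) := by
  induction j with
  | zero => simpa using sq_noiseCov_le h0 h1 hg r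
  | succ j ih =>
    rw [pow_succ 2 (j + 1), pow_mul, pow_mul]
    refine le_trans ?_ (sq_noiseCov_le h0 h1 hg _)
    have : 0 ≤ noiseCov p g r ^ 2 ^ (j + 1) := by
      rw [pow_succ, pow_mul]; positivity
    gcongr

/-- The quantitative Benjamini–Kalai–Schramm bound at one small retention probability. -/
lemma noiseCov_sq_le_sum_absMean {δ : ℝ} (hδ : 0 < δ) (h0 : δ ≤ p) (h1 : p ≤ 1 - δ)
    {g : (Fin m → Bool) → ℝ} (hg : corr p g g ≤ 1) :
    noiseCov p g ((δ / 4) ^ 2) ^ 2 ≤ 2 * ∑ i, absMean p (coordLap p i g) ^ 2 := by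
  have hp0 : 0 ≤ p := by linarith
  have hp1 : p ≤ 1 := by linarith
  set a : Fin m → (Fin m → Bool) → ℝ := fun i => noiseOp p (fun _ => 1 / 2) (coordLap p i g)
  have hL2 : ∑ i, corr p (a i) (a i) ≤ 2 := by
    have := sum_corr_noiseOp_coordLap_le (m := m) hp0 hp1 (r := 1 / 2) (by norm_num) (by norm_num)
      g Finset.univ
    have hn := corr_self_nonneg hp0 hp1 (noiseOp p (retainOn Finset.univ (1 / 2)) g)
    norm_num [a] at this hn ⊢
    linarith
  have hcov : noiseCov p g ((δ / 4) ^ 2) ≤ ∑ i, corr p (noiseOp p (fun _ => δ / 2) (a i))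
      (noiseOp p (fun _ => δ / 2) (a i)) := by
    have := corr_self_sub_le_sum_coordLap hp0 hp1 (noiseOp p (fun _ => δ / 4) g) Finset.univ
    rw [retainOn_univ, noiseOp_const_noiseOp_const, corr_noiseOp_const, corr_noiseOp_const] at this
    simp only [← noiseOp_coordLap] at this
    simp only [a, noiseOp_const_noiseOp_const]
    rw [noiseCov]
    convert this using 3 <;> ring_nf
  calc noiseCov p g ((δ / 4) ^ 2) ^ 2 ≤ _ :=
        pow_le_pow_left₀ (noiseCov_sq_nonneg hp0 hp1 _ _) hcov 2
    _ ≤ (∑ i, absMean p (a i) ^ 2) * ∑ i, corr p (a i) (a i) :=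
        Finset.sum_sq_le_sum_mul_sum_of_sq_le_mul _ (fun i _ => sq_nonneg _)
          (fun i _ => corr_self_nonneg hp0 hp1 _) (fun i _ => corr_noiseOp_sq_le hδ h0 h1 (a i))
    _ ≤ (∑ i, absMean p (a i) ^ 2) * 2 :=
        mul_le_mul_of_nonneg_left hL2 (Finset.sum_nonneg fun i _ => sq_nonneg _)
    _ ≤ 2 * ∑ i, absMean p (coordLap p i g) ^ 2 := by
        rw [mul_comm]
        gcongr with i
        · exact absMean_nonneg hp0 hp1 _
        · exact absMean_noiseOp_le hp0 hp1 (fun _ => by norm_num) (fun _ => by norm_num) _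

end

section
variable {m : ℕ} {p : ℝ}

lemma isProbabilityMeasure_bern (h0 : 0 ≤ p) (h1 : p ≤ 1) : IsProbabilityMeasure (bern p) := by
  constructor
  simp [bern, ← ENNReal.ofReal_add h0 (sub_nonneg.2 h1)]

lemma bern_real_singleton (h0 : 0 ≤ p) (h1 : p ≤ 1) (b : Bool) : (bern p).real {b} = bwt p b := by
  cases b <;> simp [bern, bwt, measureReal_def, h0, h1]

lemma pi_bern_real_singleton (h0 : 0 ≤ p) (h1 : p ≤ 1) (x : Fin m → Bool) :
    (Measure.pi fun _ : Fin m => bern p).real {x} = wt p x := by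
  have := isProbabilityMeasure_bern h0 h1
  rw [measureReal_def, Measure.pi_singleton, ENNReal.toReal_prod]
  exact Finset.prod_congr rfl fun i _ => bern_real_singleton h0 h1 _

lemma influence_eq_sum (h0 : 0 ≤ p) (h1 : p ≤ 1) (f : (Fin m → Bool) → Bool) (i : Fin m) :
    influence m p f i = ∑ x, wt p x * ∑ b, bwt p b *
      (if f x ≠ f (Function.update x i b) then 1 else 0) := by
  have := isProbabilityMeasure_bern h0 h1
  rw [influence, ← measureReal_def]
  set μ := (Measure.pi fun _ : Fin m => bern p).prod (bern p)
  set A : Set ((Fin m → Bool) × Bool) := {σ | f σ.1 ≠ f (Function.update σ.1 i σ.2)}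
  have hA : μ.real A = ∫ σ, A.indicator 1 σ ∂μ :=
    (integral_indicator_one (Set.toFinite A).measurableSet).symm
  rw [hA, integral_fintype .of_finite, Fintype.sum_prod_type]
  refine Finset.sum_congr rfl fun x _ => ?_
  rw [Finset.mul_sum]
  refine Finset.sum_congr rfl fun b _ => ?_
  rw [← Set.singleton_prod_singleton, measureReal_prod_prod, pi_bern_real_singleton h0 h1,
    bern_real_singleton h0 h1, smul_eq_mul, mul_assoc]
  simp [A, Set.indicator_apply]

lemma noiseOp_retainOn_singleton_zero (i : Fin m) (g : (Fin m → Bool) → ℝ) (x : Fin m → Bool) :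
    noiseOp p (retainOn {i} 0) g x = ∑ b, bwt p b * g (Function.update x i b) := by
  have hker (y : Fin m → Bool) : noiseKer p (retainOn {i} 0) x y =
      ∑ b, if y = Function.update x i b then bwt p b else 0 := by
    by_cases h : ∃ j, j ≠ i ∧ x j ≠ y j
    · obtain ⟨j, hji, hj⟩ := h
      rw [noiseKer, Finset.prod_eq_zero (Finset.mem_univ j) (by simp [site, retainOn, hji, hj])]
      refine (Finset.sum_eq_zero fun b _ => if_neg fun hy => hj ?_).symm
      rw [hy, Function.update_of_ne hji]
    · push Not at h
      have hy (b : Bool) : y = Function.update x i b ↔ y i = b := by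
        refine ⟨fun e => by rw [e, Function.update_self], fun e => ?_⟩
        funext j
        by_cases hj : j = i
        · rw [hj, Function.update_self, e]
        · rw [Function.update_of_ne hj, h j hj]
      simp only [hy, Finset.sum_ite_eq, Finset.mem_univ, if_true]
      rw [noiseKer, Finset.prod_eq_single i]
      · simp [site, retainOn]
      · intro j _ hj
        simp [site, retainOn, hj, h j hj]
      · simp
  simp only [noiseOp, hker, Finset.sum_mul]
  rw [Finset.sum_comm]
  simp

lemma absMean_coordLap_le_influence (h0 : 0 ≤ p) (h1 : p ≤ 1) (f : (Fin m → Bool) → Bool)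
    (i : Fin m) : absMean p (coordLap p i fun x => bval (f x)) ≤ influence m p f i := by
  rw [influence_eq_sum h0 h1]
  refine Finset.sum_le_sum fun x _ => mul_le_mul_of_nonneg_left ?_ (wt_nonneg h0 h1 x)
  have : coordLap p i (fun x => bval (f x)) x =
      ∑ b, bwt p b * (bval (f x) - bval (f (Function.update x i b))) := by
    simp only [coordLap, Pi.sub_apply, noiseOp_retainOn_singleton_zero, mul_sub,
      Finset.sum_sub_distrib, ← Finset.sum_mul, sum_bwt, one_mul]
  rw [this]
  refine (Finset.abs_sum_le_sum_abs _ _).trans (Finset.sum_le_sum fun b _ => ?_)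
  rw [abs_mul, abs_of_nonneg (bwt_nonneg h0 h1 b)]
  refine mul_le_mul_of_nonneg_left ?_ (bwt_nonneg h0 h1 b)
  cases f x <;> cases f (Function.update x i b) <;> simp [bval]

lemma integral_noiseμ (h0 : 0 ≤ p) (h1 : p ≤ 1) {ε : ℝ} (hε0 : 0 ≤ ε) (hε1 : ε ≤ 1)
    (F : (Fin m → Bool) → (Fin m → Bool) → ℝ) :
    ∫ σ, F (obs σ) (pert σ) ∂(noiseμ m p ε) =
      ∑ x, ∑ y, wt p x * noiseKer p (fun _ => 1 - ε) x y * F x y := by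
  have := isProbabilityMeasure_bern h0 h1
  have := isProbabilityMeasure_bern hε0 hε1
  set q : Bool × Bool × Bool → ℝ := fun c => bwt p c.1 * (bwt p c.2.1 * bwt ε c.2.2)
  have hmass (σ : Fin m → Bool × Bool × Bool) : (noiseμ m p ε).real {σ} = ∏ i, q (σ i) := by
    rw [noiseμ, measureReal_def, Measure.pi_singleton, ENNReal.toReal_prod]
    refine Finset.prod_congr rfl fun i _ => ?_
    rw [← measureReal_def, ← Prod.mk.eta (p := σ i), ← Prod.mk.eta (p := (σ i).2),
      ← Set.singleton_prod_singleton, ← Set.singleton_prod_singleton, measureReal_prod_prod,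
      measureReal_prod_prod, bern_real_singleton h0 h1, bern_real_singleton h0 h1,
      bern_real_singleton hε0 hε1]
  have hprob : IsProbabilityMeasure (noiseμ m p ε) := by unfold noiseμ; infer_instance
  have hsite (a b : Bool) : ∑ c : Bool × Bool × Bool,
      q c * (if c.1 = a ∧ (if c.2.2 then c.2.1 else c.1) = b then 1 else 0) =
        bwt p a * site p (1 - ε) a b := by
    cases a <;> cases b <;> simp [Fintype.sum_prod_type, q, bwt, site, -mul_eq_mul_left_iff] <;>
      ring
  have hjoint (x y : Fin m → Bool) : wt p x * noiseKer p (fun _ => 1 - ε) x y =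
      ∑ σ : Fin m → Bool × Bool × Bool,
        (∏ i, q (σ i)) * (if obs σ = x ∧ pert σ = y then 1 else 0) := by
    rw [wt, noiseKer, ← Finset.prod_mul_distrib]
    simp only [← hsite]
    rw [Fintype.prod_sum (fun i c =>
      q c * (if c.1 = x i ∧ (if c.2.2 then c.2.1 else c.1) = y i then 1 else 0))]
    refine Finset.sum_congr rfl fun σ _ => ?_
    rw [Finset.prod_mul_distrib, Finset.prod_ite_zero, Finset.prod_const_one]
    simp [obs, pert, funext_iff, forall_and]
  rw [integral_fintype .of_finite]
  simp only [hmass, hjoint, Finset.sum_mul, smul_eq_mul]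
  rw [Finset.sum_congr rfl fun x _ => Finset.sum_comm, Finset.sum_comm]
  refine Finset.sum_congr rfl fun σ _ => ?_
  simp [ite_and]

lemma noiseOp_const_zero (g : (Fin m → Bool) → ℝ) (x : Fin m → Bool) :
    noiseOp p (fun _ => 0) g x = ∑ y, wt p y * g y := by
  simp [noiseOp, noiseKer, site, wt]

lemma integral_sub_sq_eq_noiseCov (h0 : 0 ≤ p) (h1 : p ≤ 1) {ε : ℝ} (hε0 : 0 ≤ ε) (hε1 : ε ≤ 1)
    (g : (Fin m → Bool) → ℝ) :
    (∫ σ, g (obs σ) * g (pert σ) ∂(noiseμ m p ε)) - (∫ σ, g (obs σ) ∂(noiseμ m p ε)) ^ 2 =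
      noiseCov p g (1 - ε) := by
  rw [integral_noiseμ h0 h1 hε0 hε1 fun x y => g x * g y,
    integral_noiseμ h0 h1 hε0 hε1 fun x _ => g x, noiseCov]
  congr 1
  · simp only [corr, noiseOp, Finset.mul_sum]
    exact Finset.sum_congr rfl fun x _ => Finset.sum_congr rfl fun y _ => by ring
  · simp only [corr, noiseOp_const_zero, ← Finset.sum_mul, ← Finset.mul_sum, sum_noiseKer, mul_one,
      ← mul_assoc, sq]

lemma corr_bval_le_one (h0 : 0 ≤ p) (h1 : p ≤ 1) (f : (Fin m → Bool) → Bool) :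
    corr p (fun x => bval (f x)) (fun x => bval (f x)) ≤ 1 := by
  rw [← sum_wt (m := m) (p := p)]
  refine Finset.sum_le_sum fun x _ => mul_le_of_le_one_right (wt_nonneg h0 h1 x) ?_
  dsimp only
  cases f x <;> simp [bval]

/-- The quantitative Benjamini–Kalai–Schramm bound. -/
lemma noiseCov_pow_le_sum_influence {δ : ℝ} (hδ : 0 < δ) (h0 : δ ≤ p) (h1 : p ≤ 1 - δ) {r : ℝ}
    {j : ℕ} (hr0 : 0 ≤ r) (hj : r ^ 2 ^ j ≤ δ / 4) (f : (Fin m → Bool) → Bool) :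
    (noiseCov p (fun x => bval (f x)) r ^ 2 ^ (j + 1)) ^ 2 ≤
      2 * ∑ i, influence m p f i ^ 2 := by
  have hp0 : 0 ≤ p := by linarith
  have hp1 : p ≤ 1 := by linarith
  have hg := corr_bval_le_one hp0 hp1 f
  have hpow := pow_noiseCov_le hp0 hp1 hg r j
  rw [pow_succ 2 j, pow_mul r] at hpow
  have hle := hpow.trans (noiseCov_sq_mono hp0 hp1 (pow_nonneg hr0 _) hj _)
  have hnn : 0 ≤ noiseCov p (fun x => bval (f x)) r ^ 2 ^ (j + 1) := by
    rw [pow_succ, pow_mul]; positivity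
  refine (pow_le_pow_left₀ hnn hle 2).trans ((noiseCov_sq_le_sum_absMean hδ h0 h1 hg).trans ?_)
  gcongr with i
  · exact absMean_nonneg hp0 hp1 _
  · exact absMean_coordLap_le_influence hp0 hp1 f i

end

/-- Benjamini–Kalai–Schramm: if {p_n} is bounded away from 0 and 1 and
Σ_i I_i^{p_n}(f_n)² → 0, then {f_n} is noise sensitive with respect to {p_n}: for every
ε > 0, E[f_n(ω_n)f_n(ω_n^ε)] − E[f_n(ω_n)]² → 0. -/
theorem stmt_1 (m : ℕ → ℕ) (p : ℕ → ℝ) (f : ∀ n, (Fin (m n) → Bool) → Bool)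
    (δ : ℝ) (hδ : 0 < δ) (hp : ∀ n, δ ≤ p n ∧ p n ≤ 1 - δ)
    (hinf : Filter.Tendsto (fun n => ∑ i : Fin (m n), (influence (m n) (p n) (f n) i)^2)
      Filter.atTop (nhds 0)) :
    ∀ ε : ℝ, 0 < ε → ε ≤ 1 →
      Filter.Tendsto (fun n =>
        (∫ σ, bval (f n (obs σ)) * bval (f n (pert σ)) ∂(noiseμ (m n) (p n) ε)) -
        (∫ σ, bval (f n (obs σ)) ∂(noiseμ (m n) (p n) ε)) ^ 2)
      Filter.atTop (nhds 0) := by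
  intro ε hε0 hε1
  have hp0 (n : ℕ) : 0 ≤ p n := by linarith [(hp n).1]
  have hp1 (n : ℕ) : p n ≤ 1 := by linarith [(hp n).2]
  obtain ⟨k, hk⟩ := exists_pow_lt_of_lt_one (by positivity : 0 < δ / 4) (by linarith : 1 - ε < 1)
  have hr0 : 0 ≤ 1 - ε := by linarith
  have hk' : (1 - ε) ^ 2 ^ k ≤ δ / 4 :=
    (pow_le_pow_of_le_one hr0 (by linarith) Nat.lt_two_pow_self.le).trans hk.le
  have hcov (n : ℕ) := integral_sub_sq_eq_noiseCov (hp0 n) (hp1 n) hε0.le hε1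
    (fun x => bval (f n x))
  simp only [hcov]
  rw [Metric.tendsto_atTop]
  intro η hη
  have hsmall := (hinf.const_mul 2).eventually (gt_mem_nhds
    (by rw [mul_zero]; positivity : 2 * 0 < (η ^ 2 ^ (k + 1)) ^ 2))
  obtain ⟨N, hN⟩ := Filter.eventually_atTop.1 hsmall
  refine ⟨N, fun n hn => ?_⟩
  have hlt := (noiseCov_pow_le_sum_influence hδ (hp n).1 (hp n).2 hr0 hk' (f n)).trans_lt (hN n hn)
  rw [Real.dist_eq, sub_zero]
  rw [← sq_abs, abs_pow] at hlt
  exact lt_of_pow_lt_pow_left₀ _ hη.le (lt_of_pow_lt_pow_left₀ 2 (by positivity) hlt)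
end

section
/- (Broman) Let p ∈ [0,1] and let f_n : {0,1}^{m_n} → {0,1} be a monotone sequence of Boolean functions, i.e. m_{n−1} ≤ m_n and for every ω ∈ {0,1}^{m_n}, f_n(ω) = 1 implies f_{n−1}(ω') = 1 where ω' is the restriction of ω to its first m_{n−1} coordinates. Then {f_n} is noise stable with respect to p_n ≡ p. -/
open MeasureTheory

section Bernoulli

variable {p ε : ℝ}

lemma isProbabilityMeasure_bern_s2 (hp0 : 0 ≤ p) (hp1 : p ≤ 1) : IsProbabilityMeasure (bern p) :=
  ⟨by simp [bern, ← ENNReal.ofReal_add hp0 (sub_nonneg.2 hp1)]⟩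

/-- Resampling a Bernoulli bit with probability `ε` preserves its law. -/
lemma map_resample_bern (hp0 : 0 ≤ p) (hp1 : p ≤ 1) (hε0 : 0 ≤ ε) (hε1 : ε ≤ 1) :
    ((bern p).prod ((bern p).prod (bern ε))).map (fun x => if x.2.2 then x.2.1 else x.1)
      = bern p := by
  have := isProbabilityMeasure_bern_s2 hp0 hp1
  have := isProbabilityMeasure_bern_s2 hε0 hε1
  have hsplit (s : Set Bool) :
      (fun x : Bool × Bool × Bool => if x.2.2 then x.2.1 else x.1) ⁻¹' s
        = (Set.univ ×ˢ (s ×ˢ {true})) ∪ (s ×ˢ (Set.univ ×ˢ {false})) := by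
    ext ⟨a, b, c⟩
    cases c <;> simp
  ext s hs
  rw [Measure.map_apply (by fun_prop) hs, hsplit,
    measure_union _ (Set.toFinite _).measurableSet]
  · simp only [Measure.prod_prod, measure_univ, one_mul]
    rw [← mul_add]
    have h : bern ε {true} + bern ε {false} = 1 := by
      simp [bern, ← ENNReal.ofReal_add hε0 (sub_nonneg.2 hε1)]
    rw [h, mul_one]
  · rw [Set.disjoint_left]
    rintro ⟨a, b, c⟩ h h'
    simp_all

lemma isProbabilityMeasure_noiseμ (m : ℕ) (hp0 : 0 ≤ p) (hp1 : p ≤ 1) (hε0 : 0 ≤ ε)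
    (hε1 : ε ≤ 1) : IsProbabilityMeasure (noiseμ m p ε) := by
  have := isProbabilityMeasure_bern_s2 hp0 hp1
  have := isProbabilityMeasure_bern_s2 hε0 hε1
  unfold noiseμ
  infer_instance

lemma measurePreserving_obs (m : ℕ) (hp0 : 0 ≤ p) (hp1 : p ≤ 1) (hε0 : 0 ≤ ε) (hε1 : ε ≤ 1) :
    MeasurePreserving obs (noiseμ m p ε) (Measure.pi fun _ => bern p) := by
  have := isProbabilityMeasure_bern_s2 hp0 hp1
  have := isProbabilityMeasure_bern_s2 hε0 hε1
  exact measurePreserving_pi _ _ fun _ => measurePreserving_fst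

lemma measurePreserving_pert (m : ℕ) (hp0 : 0 ≤ p) (hp1 : p ≤ 1) (hε0 : 0 ≤ ε) (hε1 : ε ≤ 1) :
    MeasurePreserving pert (noiseμ m p ε) (Measure.pi fun _ => bern p) := by
  have := isProbabilityMeasure_bern_s2 hp0 hp1
  have := isProbabilityMeasure_bern_s2 hε0 hε1
  exact measurePreserving_pi (f := fun _ (x : Bool × Bool × Bool) => if x.2.2 then x.2.1 else x.1) _ _
    fun _ => ⟨by fun_prop, map_resample_bern hp0 hp1 hε0 hε1⟩

lemma noiseμ_real_resampled {m : ℕ} (hp0 : 0 ≤ p) (hp1 : p ≤ 1) (hε0 : 0 ≤ ε) (hε1 : ε ≤ 1)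
    (i : Fin m) : (noiseμ m p ε).real {σ | (σ i).2.2 = true} = ε := by
  have := isProbabilityMeasure_bern_s2 hp0 hp1
  have := isProbabilityMeasure_bern_s2 hε0 hε1
  have h : MeasurePreserving (fun σ : Fin m → Bool × Bool × Bool => (σ i).2.2)
      (noiseμ m p ε) (bern ε) :=
    measurePreserving_snd.comp (measurePreserving_snd.comp (measurePreserving_eval _ i))
  have h' := h.measureReal_preimage (s := {true}) (Set.toFinite _).measurableSet.nullMeasurableSet
  have h_true : (bern ε).real {true} = ε := by simp [bern, Measure.real, hε0]
  exact h'.trans h_true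

/-- A union bound: functions of `k` coordinates are insensitive to noise up to `k * ε`. -/
lemma noiseμ_real_restrict_ne_le {m k : ℕ} {α : Type*} (hp0 : 0 ≤ p) (hp1 : p ≤ 1) (hε0 : 0 ≤ ε)
    (hε1 : ε ≤ 1) (e : Fin k → Fin m) (g : (Fin k → Bool) → α) :
    (noiseμ m p ε).real {σ | g (obs σ ∘ e) ≠ g (pert σ ∘ e)} ≤ k * ε := by
  have := isProbabilityMeasure_noiseμ m hp0 hp1 hε0 hε1
  have hsub : {σ : Fin m → Bool × Bool × Bool | g (obs σ ∘ e) ≠ g (pert σ ∘ e)}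
      ⊆ ⋃ i : Fin k, {σ | (σ (e i)).2.2 = true} := by
    intro σ hσ
    by_contra hne
    simp only [Set.mem_iUnion, Set.mem_ofPred_eq, not_exists] at hne
    exact hσ (congrArg g (funext fun i => by simp [obs, pert, hne i]))
  calc _ ≤ (noiseμ m p ε).real (⋃ i : Fin k, {σ | (σ (e i)).2.2 = true}) := measureReal_mono hsub
    _ ≤ ∑ i : Fin k, (noiseμ m p ε).real {σ | (σ (e i)).2.2 = true} :=
      measureReal_iUnion_fintype_le _
    _ = k * ε := by simp [noiseμ_real_resampled hp0 hp1 hε0 hε1]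

end Bernoulli

/-- Restricting an i.i.d. family along an injection preserves the product law. -/
lemma measurePreserving_pi_comp {ι κ α : Type*} [Fintype ι] [Fintype κ] [MeasurableSpace α]
    (μ : Measure α) [IsProbabilityMeasure μ] {e : κ → ι} (he : Function.Injective e) :
    MeasurePreserving (fun ω : ι → α => ω ∘ e) (Measure.pi fun _ => μ)
      (Measure.pi fun _ => μ) := by
  have hmeas (i : ι) : Measurable (fun ω : ι → α => ω i) := measurable_pi_apply i
  have hind : ProbabilityTheory.iIndepFun (fun (i : ι) (ω : ι → α) => ω i)
      (Measure.pi fun _ => μ) :=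
    ProbabilityTheory.iIndepFun_pi (X := fun _ => id) fun _ => aemeasurable_id
  have h := (ProbabilityTheory.iIndepFun_iff_map_fun_eq_pi_map
    fun i => (hmeas (e i)).aemeasurable).1 (hind.precomp he)
  refine ⟨measurable_pi_lambda _ fun i => hmeas (e i), h.trans ?_⟩
  congr 1
  funext i
  exact (measurePreserving_eval (fun _ => μ) (e i)).map_eq

lemma restrict_eq_true_of_le {m : ℕ → ℕ} (hm : ∀ n, m n ≤ m (n+1))
    (f : ∀ n, (Fin (m n) → Bool) → Bool)
    (hmono : ∀ n (ω : Fin (m (n+1)) → Bool),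
      f (n+1) ω = true → f n (fun i => ω (Fin.castLE (hm n) i)) = true)
    {k n : ℕ} (hkn : k ≤ n) (ω : Fin (m n) → Bool) (hω : f n ω = true) :
    f k (ω ∘ Fin.castLE (monotone_nat_of_le_succ hm hkn)) = true := by
  induction n, hkn using Nat.le_induction with
  | base => exact hω
  | succ n hkn ih => exact ih _ (hmono n ω hω)

/-- Broman: a monotone sequence of Boolean functions (f_{n+1}(ω) = 1 implies
f_n(ω') = 1 for the restriction ω' of ω to the first m_n coordinates) is noise stable
with respect to p_n ≡ p: for every δ > 0 there is ε > 0 with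
sup_n P(f_n(ω_n) ≠ f_n(ω_n^ε)) ≤ δ. -/
theorem stmt_2 (p : ℝ) (hp0 : 0 ≤ p) (hp1 : p ≤ 1)
    (m : ℕ → ℕ) (hm : ∀ n, m n ≤ m (n+1))
    (f : ∀ n, (Fin (m n) → Bool) → Bool)
    (hmono : ∀ n (ω : Fin (m (n+1)) → Bool),
      f (n+1) ω = true → f n (fun i => ω (Fin.castLE (hm n) i)) = true) :
    ∀ δ : ℝ, 0 < δ → ∃ ε : ℝ, 0 < ε ∧ ∀ n,
      ((noiseμ (m n) p ε) {σ | f n (obs σ) ≠ f n (pert σ)}).toReal ≤ δ := by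
  intro δ hδ
  have := isProbabilityMeasure_bern_s2 hp0 hp1
  set ν : ∀ k, Measure (Fin k → Bool) := fun k => Measure.pi fun _ => bern p
  have hm' : Monotone m := monotone_nat_of_le_succ hm
  have hms {k : ℕ} (s : Set (Fin k → Bool)) : NullMeasurableSet s (ν k) :=
    (Set.toFinite s).measurableSet.nullMeasurableSet
  set a : ℕ → ℝ := fun n => (ν (m n)).real {ω | f n ω = true}
  have hdiff {k n : ℕ} (hkn : k ≤ n) :
      (ν (m n)).real ({ω | f k (ω ∘ Fin.castLE (hm' hkn)) = true} \ {ω | f n ω = true})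
        = a k - a n := by
    rw [measureReal_sdiff (s₁ := {ω | f k (ω ∘ Fin.castLE (hm' hkn)) = true})
      (s₂ := {ω | f n ω = true}) (restrict_eq_true_of_le hm f hmono hkn) (Set.toFinite _).measurableSet]
    congr 1
    exact (measurePreserving_pi_comp (bern p)
      (Fin.castLE_injective (hm' hkn))).measureReal_preimage (hms {ω | f k ω = true})
  have hanti : Antitone a := fun k n hkn => sub_nonneg.1 (hdiff hkn ▸ measureReal_nonneg)
  have hbdd : BddBelow (Set.range a) := ⟨0, by rintro _ ⟨n, rfl⟩; exact measureReal_nonneg⟩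
  obtain ⟨N, hN⟩ := exists_lt_of_ciInf_lt (f := a) (lt_add_of_pos_right (⨅ n, a n)
    (show 0 < δ / 4 by linarith))
  have hmN : (0 : ℝ) < m N + 1 := by positivity
  obtain ⟨ε, hε, hεle⟩ : ∃ ε, 0 < ε ∧ ε ≤ min 1 (δ / 2 / (m N + 1)) := ⟨_, by positivity, le_rfl⟩
  have hε1 : ε ≤ 1 := hεle.trans (min_le_left _ _)
  have hεN : m N * ε ≤ δ / 2 := by
    have := (le_div_iff₀ hmN).1 (hεle.trans (min_le_right _ _))
    linarith
  refine ⟨ε, hε, fun n => ?_⟩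
  have := isProbabilityMeasure_noiseμ (m n) hp0 hp1 hε.le hε1
  change (noiseμ (m n) p ε).real _ ≤ δ
  rcases le_total n N with hnN | hNn
  · have h := noiseμ_real_restrict_ne_le hp0 hp1 hε.le hε1 id (f n)
    have hmn : (m n : ℝ) * ε ≤ m N * ε := by
      gcongr
      exact hm' hnN
    simp only [Function.comp_id] at h
    linarith
  · set D := {ω | f N (ω ∘ Fin.castLE (hm' hNn)) = true} \ {ω | f n ω = true} with hD
    have hsub : {σ | f n (obs σ) ≠ f n (pert σ)} ⊆
        {σ | f N (obs σ ∘ Fin.castLE (hm' hNn)) ≠ f N (pert σ ∘ Fin.castLE (hm' hNn))} ∪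
          (obs ⁻¹' D ∪ pert ⁻¹' D) := by
      intro σ hσ
      have h₁ := restrict_eq_true_of_le hm f hmono hNn (obs σ)
      have h₂ := restrict_eq_true_of_le hm f hmono hNn (pert σ)
      simp only [hD, Set.mem_union, Set.mem_ofPred_eq, Set.mem_preimage, Set.mem_sdiff] at hσ ⊢
      grind
    have h₀ := noiseμ_real_restrict_ne_le hp0 hp1 hε.le hε1 (Fin.castLE (hm' hNn)) (f N)
    have h₁ := (measurePreserving_obs (m n) hp0 hp1 hε.le hε1).measureReal_preimage (hms D)
    have h₂ := (measurePreserving_pert (m n) hp0 hp1 hε.le hε1).measureReal_preimage (hms D)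
    have h₃ : (ν (m n)).real D = a N - a n := hdiff hNn
    have h₄ := ciInf_le hbdd n
    have h₅ := (measureReal_mono hsub (μ := noiseμ (m n) p ε)).trans (measureReal_union_le _ _)
    have h₆ := measureReal_union_le (μ := noiseμ (m n) p ε) (obs ⁻¹' D) (pert ⁻¹' D)
    linarith
end
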